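/- arXiv:2501.12915 — 2 statements merged into one kernel-verified Lean document; each statement's English description precedes it below -/
import Mathlib

section
/- Suppose 1 ≤ k < n, λ > 0, and λ₁ = … = λ_k = λ while λ_{k+1} = … = λₙ = −λ. Let V = Σᵢ (aᵢ eᵢ + a_{n+i} e_{n+i}) be a unit vector of the oscillator algebra 𝔤ₙ(λ) satisfying Σ_{i=1}^{k} (aᵢ² + a_{n+i}²) = Σ_{i=k+1}^{n} (aᵢ² + a_{n+i}²) (equivalently g(V, E_λ V) = 0). Then V is a minimal unit vector field. -/
open scoped RealInnerProductSpace
open Finset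

noncomputable section

/-- The underlying inner product space of the oscillator algebra `𝔤ₙ(λ)`:
a `(2n+2)`-dimensional real inner product space. -/
abbrev Osc (n : ℕ) := EuclideanSpace ℝ (Fin (2*n+2))

/-- The basis vectors `e₁, …, eₙ`. -/
def oe (n : ℕ) (i : Fin n) : Osc n :=
  EuclideanSpace.single ⟨i.1, by have := i.2; omega⟩ 1

/-- The basis vectors `e_{n+1}, …, e_{2n}`. -/
def oE (n : ℕ) (i : Fin n) : Osc n :=
  EuclideanSpace.single ⟨n + i.1, by have := i.2; omega⟩ 1

/-- The basis vector `ξ`. -/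
def oXi (n : ℕ) : Osc n := EuclideanSpace.single ⟨2*n, by omega⟩ 1

/-- The basis vector `ζ`. -/
def oZeta (n : ℕ) : Osc n := EuclideanSpace.single ⟨2*n+1, by omega⟩ 1

/-- `br` is the Lie bracket of the oscillator algebra `𝔤ₙ(λ)`: the bilinear map
determined by `[eᵢ, e_{n+j}] = δᵢⱼ ξ`, `[ζ, eⱼ] = λⱼ e_{n+j}`, `[ζ, e_{n+j}] = −λⱼ eⱼ`,
all other brackets of basis vectors being zero. -/
structure IsOscBracket (n : ℕ) (lam : Fin n → ℝ)
    (br : Osc n →ₗ[ℝ] Osc n →ₗ[ℝ] Osc n) : Prop where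
  anti : ∀ X Y : Osc n, br X Y = - br Y X
  ee : ∀ i j : Fin n, br (oe n i) (oe n j) = 0
  eE : ∀ i j : Fin n, br (oe n i) (oE n j) = if i = j then oXi n else 0
  EE : ∀ i j : Fin n, br (oE n i) (oE n j) = 0
  exi : ∀ i : Fin n, br (oe n i) (oXi n) = 0
  Exi : ∀ i : Fin n, br (oE n i) (oXi n) = 0
  zee : ∀ j : Fin n, br (oZeta n) (oe n j) = lam j • oE n j
  zeE : ∀ j : Fin n, br (oZeta n) (oE n j) = - (lam j • oe n j)
  xize : br (oXi n) (oZeta n) = 0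

/-- `nab` is the Levi-Civita connection of the left-invariant metric (evaluated on
left-invariant fields): the bilinear map determined by the Koszul formula
`2 g(∇_X Y, Z) = g([X,Y], Z) − g([Y,Z], X) + g([Z,X], Y)`. -/
def IsLeviCivita (n : ℕ) (br nab : Osc n →ₗ[ℝ] Osc n →ₗ[ℝ] Osc n) : Prop :=
  ∀ X Y Z : Osc n,
    2 * ⟪nab X Y, Z⟫ = ⟪br X Y, Z⟫ - ⟪br Y Z, X⟫ + ⟪br Z X, Y⟫

/-- The Nomizu operator `A_V X = −∇_X V`. -/
def nomizu {n : ℕ} (nab : Osc n →ₗ[ℝ] Osc n →ₗ[ℝ] Osc n) (V X : Osc n) : Osc n :=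
  -(nab X V)

/-- The covariant derivative of the Nomizu operator:
`(∇_X A_V) Y = ∇_X (A_V Y) − A_V (∇_X Y)`. -/
def covNomizu {n : ℕ} (nab : Osc n →ₗ[ℝ] Osc n →ₗ[ℝ] Osc n) (V X Y : Osc n) : Osc n :=
  nab X (nomizu nab V Y) - nomizu nab V (nab X Y)

/-- The curvature tensor `R(X,Y)Z = ∇_X ∇_Y Z − ∇_Y ∇_X Z − ∇_{[X,Y]} Z`. -/
def curvR {n : ℕ} (br nab : Osc n →ₗ[ℝ] Osc n →ₗ[ℝ] Osc n) (X Y Z : Osc n) : Osc n :=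
  nab X (nab Y Z) - nab Y (nab X Z) - nab (br X Y) Z

/-- A unit vector `V ∈ 𝔤ₙ(λ)` is a *minimal* unit vector field if there is an orthonormal
basis `u₁, …, u_{2n+2}` of eigenvectors of `A_Vᵀ A_V` (the eigenvector condition being
expressed as `g(A_V W, A_V uᵢ) = σᵢ² g(W, uᵢ)` for all `W`) with eigenvalues `σᵢ²` such that
`Σᵢ ((∇_{uᵢ} A_V)uᵢ + A_V R(V, A_V uᵢ)uᵢ)/(1 + σᵢ²) = (Σᵢ σᵢ²/(1 + σᵢ²)) V`. -/
def IsMinimal {n : ℕ} (br nab : Osc n →ₗ[ℝ] Osc n →ₗ[ℝ] Osc n) (V : Osc n) : Prop :=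
  ∃ (u : Fin (2*n+2) → Osc n) (σ : Fin (2*n+2) → ℝ),
    (∀ i j, ⟪u i, u j⟫ = if i = j then 1 else 0) ∧
    (∀ i, ∀ W : Osc n,
      ⟪nomizu nab V W, nomizu nab V (u i)⟫ = (σ i)^2 * ⟪W, u i⟫) ∧
    (∑ i, (1 + (σ i)^2)⁻¹ •
        (covNomizu nab V (u i) (u i) +
          nomizu nab V (curvR br nab V (nomizu nab V (u i)) (u i))))
      = (∑ i, (σ i)^2 / (1 + (σ i)^2)) • V

/-- The operator `φ` with `φ eᵢ = e_{n+i}`, `φ e_{n+i} = −eᵢ`, `φ ξ = φ ζ = 0`. -/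
structure IsPhi (n : ℕ) (phi : Osc n →ₗ[ℝ] Osc n) : Prop where
  he : ∀ i : Fin n, phi (oe n i) = oE n i
  hE : ∀ i : Fin n, phi (oE n i) = - oe n i
  hxi : phi (oXi n) = 0
  hzeta : phi (oZeta n) = 0

/-- The operator `E_λ` with `E_λ eᵢ = λᵢ eᵢ`, `E_λ e_{n+i} = λᵢ e_{n+i}`, `E_λ ξ = E_λ ζ = 0`. -/
structure IsElam (n : ℕ) (lam : Fin n → ℝ) (El : Osc n →ₗ[ℝ] Osc n) : Prop where
  he : ∀ i : Fin n, El (oe n i) = lam i • oe n i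
  hE : ∀ i : Fin n, El (oE n i) = lam i • oE n i
  hxi : El (oXi n) = 0
  hzeta : El (oZeta n) = 0

/-- The four families of basis vectors span, so they determine linear maps. -/
theorem Osc.linearMap_ext {n : ℕ} {M : Type*} [AddCommGroup M] [Module ℝ M]
    {f g : Osc n →ₗ[ℝ] M}
    (he : ∀ i, f (oe n i) = g (oe n i)) (hE : ∀ i, f (oE n i) = g (oE n i))
    (hxi : f (oXi n) = g (oXi n)) (hzeta : f (oZeta n) = g (oZeta n)) : f = g := by
  refine (EuclideanSpace.basisFun (Fin (2 * n + 2)) ℝ).toBasis.ext fun i => ?_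
  obtain ⟨i, hi⟩ := i
  simp only [OrthonormalBasis.coe_toBasis, EuclideanSpace.basisFun_apply]
  rcases lt_or_ge i n with h | h
  · exact he ⟨i, h⟩
  rcases lt_or_ge i (2 * n) with h' | h'
  · have := hE ⟨i - n, by omega⟩
    simpa only [oE, Nat.add_sub_cancel' h] using this
  rcases Nat.eq_or_lt_of_le h' with rfl | h''
  · exact hxi
  · obtain rfl : i = 2 * n + 1 := by omega
    exact hzeta

section InnerProducts

variable {n : ℕ}

theorem inner_oe_oe (i j : Fin n) : ⟪oe n i, oe n j⟫ = if i = j then (1 : ℝ) else 0 := by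
  simp [oe, EuclideanSpace.inner_single_left, Fin.ext_iff]

theorem inner_oE_oE (i j : Fin n) : ⟪oE n i, oE n j⟫ = if i = j then (1 : ℝ) else 0 := by
  simp [oE, EuclideanSpace.inner_single_left, Fin.ext_iff]

theorem inner_oe_oE (i j : Fin n) : ⟪oe n i, oE n j⟫ = (0 : ℝ) := by
  have := i.2
  simp [oe, oE, EuclideanSpace.inner_single_left]; omega

theorem inner_oE_oe (i j : Fin n) : ⟪oE n i, oe n j⟫ = (0 : ℝ) := by
  rw [real_inner_comm, inner_oe_oE]

theorem inner_oe_oXi (i : Fin n) : ⟪oe n i, oXi n⟫ = (0 : ℝ) := by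
  have := i.2
  simp [oe, oXi, EuclideanSpace.inner_single_left]; omega

theorem inner_oE_oXi (i : Fin n) : ⟪oE n i, oXi n⟫ = (0 : ℝ) := by
  have := i.2
  simp [oE, oXi, EuclideanSpace.inner_single_left]; omega

theorem inner_oe_oZeta (i : Fin n) : ⟪oe n i, oZeta n⟫ = (0 : ℝ) := by
  have := i.2
  simp [oe, oZeta, EuclideanSpace.inner_single_left]; omega

theorem inner_oE_oZeta (i : Fin n) : ⟪oE n i, oZeta n⟫ = (0 : ℝ) := by
  have := i.2
  simp [oE, oZeta, EuclideanSpace.inner_single_left]; omega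

theorem inner_oXi_oXi : ⟪oXi n, oXi n⟫ = (1 : ℝ) := by simp [oXi]

theorem inner_oZeta_oZeta : ⟪oZeta n, oZeta n⟫ = (1 : ℝ) := by simp [oZeta]

theorem inner_oXi_oZeta : ⟪oXi n, oZeta n⟫ = (0 : ℝ) := by
  simp [oXi, oZeta, EuclideanSpace.inner_single_left]

theorem inner_oZeta_oXi : ⟪oZeta n, oXi n⟫ = (0 : ℝ) := by
  rw [real_inner_comm, inner_oXi_oZeta]

end InnerProducts

/-- The weighted rotation `eᵢ ↦ cᵢ e_{n+i}`, `e_{n+i} ↦ −cᵢ eᵢ`, `ξ, ζ ↦ 0`. -/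
def oscRot (n : ℕ) (c : Fin n → ℝ) : Osc n →ₗ[ℝ] Osc n :=
  ∑ i, c i • ((innerₛₗ ℝ (oe n i)).smulRight (oE n i) - (innerₛₗ ℝ (oE n i)).smulRight (oe n i))

section Rotation

variable {n : ℕ} (c : Fin n → ℝ)

theorem oscRot_apply (X : Osc n) :
    oscRot n c X = ∑ i, c i • (⟪oe n i, X⟫ • oE n i - ⟪oE n i, X⟫ • oe n i) := by
  simp [oscRot, LinearMap.sum_apply]

theorem oscRot_oe (j : Fin n) : oscRot n c (oe n j) = c j • oE n j := by
  simp [oscRot_apply, inner_oe_oe, inner_oE_oe]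

theorem oscRot_oE (j : Fin n) : oscRot n c (oE n j) = -(c j • oe n j) := by
  simp [oscRot_apply, inner_oE_oE, inner_oe_oE]

theorem oscRot_oXi : oscRot n c (oXi n) = 0 := by
  simp [oscRot_apply, inner_oe_oXi, inner_oE_oXi]

theorem oscRot_oZeta : oscRot n c (oZeta n) = 0 := by
  simp [oscRot_apply, inner_oe_oZeta, inner_oE_oZeta]

theorem inner_oscRot_left (X Y : Osc n) :
    ⟪oscRot n c X, Y⟫ = ∑ i, c i * (⟪oe n i, X⟫ * ⟪oE n i, Y⟫ - ⟪oE n i, X⟫ * ⟪oe n i, Y⟫) := by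
  simp [oscRot_apply, sum_inner, inner_smul_left, inner_sub_left]

/-- Weighted rotations are skew-adjoint. -/
theorem inner_oscRot_swap (X Y : Osc n) : ⟪oscRot n c X, Y⟫ = -⟪oscRot n c Y, X⟫ := by
  rw [inner_oscRot_left, inner_oscRot_left, ← Finset.sum_neg_distrib]
  exact Finset.sum_congr rfl fun i _ => by ring

theorem inner_oscRot_self (X : Osc n) : ⟪oscRot n c X, X⟫ = (0 : ℝ) := by
  have := inner_oscRot_swap c X X
  linarith

theorem inner_oscRot_oXi (X : Osc n) : ⟪oscRot n c X, oXi n⟫ = (0 : ℝ) := by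
  rw [inner_oscRot_swap, oscRot_oXi, inner_zero_left, neg_zero]

theorem inner_oscRot_oZeta (X : Osc n) : ⟪oscRot n c X, oZeta n⟫ = (0 : ℝ) := by
  rw [inner_oscRot_swap, oscRot_oZeta, inner_zero_left, neg_zero]

theorem oscRot_oscRot_horizontal {κ : ℝ} (hc : ∀ i, c i ^ 2 = κ) (a b : Fin n → ℝ) :
    oscRot n c (oscRot n c (∑ i, (a i • oe n i + b i • oE n i)))
      = -(κ • ∑ i, (a i • oe n i + b i • oE n i)) := by
  simp only [map_sum, map_add, map_smul, oscRot_oe, oscRot_oE, map_neg, Finset.smul_sum,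
    ← Finset.sum_neg_distrib]
  refine Finset.sum_congr rfl fun i _ => ?_
  rw [← hc i]
  module

theorem inner_oscRot_one_oscRot_horizontal (a b : Fin n → ℝ) :
    ⟪oscRot n 1 (∑ i, (a i • oe n i + b i • oE n i)),
      oscRot n c (∑ i, (a i • oe n i + b i • oE n i))⟫ = ∑ i, c i * (a i ^ 2 + b i ^ 2) := by
  simp only [map_sum, map_add, map_smul, oscRot_oe, oscRot_oE, sum_inner, inner_sum,
    inner_add_left, inner_add_right, inner_smul_left, inner_smul_right, inner_neg_left,
    inner_neg_right, inner_oe_oe, inner_oe_oE, inner_oE_oe, inner_oE_oE]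
  refine Finset.sum_congr rfl fun i _ => ?_
  simp
  ring

end Rotation

section Connection

variable {n : ℕ} {lam : Fin n → ℝ} {br nab : Osc n →ₗ[ℝ] Osc n →ₗ[ℝ] Osc n}

theorem IsOscBracket.apply (hbr : IsOscBracket n lam br) (X Y : Osc n) :
    br X Y = ⟪oscRot n 1 X, Y⟫ • oXi n + ⟪X, oZeta n⟫ • oscRot n lam Y
      - ⟪Y, oZeta n⟫ • oscRot n lam X := by
  have hself : ∀ Z, br Z Z = 0 := fun Z => by
    have h := hbr.anti Z Z
    have h2 : (2 : ℝ) • br Z Z = 0 := by rw [two_smul]; exact eq_neg_iff_add_eq_zero.mp h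
    exact (smul_eq_zero.mp h2).resolve_left two_ne_zero
  let B : Osc n →ₗ[ℝ] Osc n →ₗ[ℝ] Osc n := LinearMap.mk₂ ℝ
    (fun X Y => ⟪oscRot n 1 X, Y⟫ • oXi n + ⟪X, oZeta n⟫ • oscRot n lam Y
      - ⟪Y, oZeta n⟫ • oscRot n lam X)
    (fun X X' Y => by simp only [map_add, inner_add_left]; module)
    (fun r X Y => by simp only [map_smul, real_inner_smul_left]; module)
    (fun X Y Y' => by simp only [map_add, inner_add_left, inner_add_right]; module)
    (fun r X Y => by
      simp only [map_smul, real_inner_smul_left, real_inner_smul_right]; module)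
  suffices h : br = B by rw [h]; rfl
  have hB : ∀ X Y, B X Y = ⟪oscRot n 1 X, Y⟫ • oXi n + ⟪X, oZeta n⟫ • oscRot n lam Y
      - ⟪Y, oZeta n⟫ • oscRot n lam X := fun _ _ => rfl
  refine Osc.linearMap_ext (fun i => Osc.linearMap_ext (fun j => ?_) (fun j => ?_) ?_ ?_)
    (fun i => Osc.linearMap_ext (fun j => ?_) (fun j => ?_) ?_ ?_)
    (Osc.linearMap_ext (fun j => ?_) (fun j => ?_) ?_ ?_)
    (Osc.linearMap_ext (fun j => ?_) (fun j => ?_) ?_ ?_)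
  all_goals
    simp only [hB, oscRot_oe, oscRot_oE, oscRot_oXi, oscRot_oZeta, inner_oe_oZeta,
      inner_oE_oZeta, inner_oXi_oZeta, inner_oZeta_oZeta, real_inner_smul_left, inner_neg_left,
      inner_oe_oe, inner_oe_oE, inner_oE_oe, inner_oE_oE, inner_oe_oXi, inner_oE_oXi,
      inner_zero_left]
  · simp [hbr.ee]
  · simp [hbr.eE]
  · simp [hbr.exi]
  · simp [hbr.anti (oe n i), hbr.zee]
  · rw [hbr.anti, hbr.eE]
    by_cases h : i = j
    · simp [h]
    · simp [h, Ne.symm h]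
  · simp [hbr.EE]
  · simp [hbr.Exi]
  · simp [hbr.anti (oE n i), hbr.zeE]
  · simp [hbr.anti (oXi n), hbr.exi]
  · simp [hbr.anti (oXi n), hbr.Exi]
  · simp [hself]
  · simp [hbr.xize]
  · simp [hbr.zee]
  · simp [hbr.zeE]
  · simp [hbr.anti (oZeta n), hbr.xize]
  · simp [hself]

theorem IsLeviCivita.apply (hbr : IsOscBracket n lam br) (hlc : IsLeviCivita n br nab)
    (X Y : Osc n) :
    nab X Y = (1 / 2 * ⟪oscRot n 1 X, Y⟫) • oXi n - (1 / 2 * ⟪Y, oXi n⟫) • oscRot n 1 X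
      - (1 / 2 * ⟪X, oXi n⟫) • oscRot n 1 Y + ⟪X, oZeta n⟫ • oscRot n lam Y := by
  refine ext_inner_right ℝ fun Z => ?_
  have h := hlc X Y Z
  simp only [hbr.apply, inner_add_left, inner_sub_left, real_inner_smul_left] at h ⊢
  rw [real_inner_comm X (oXi n), real_inner_comm Y (oXi n), inner_oscRot_swap 1 Z X,
    inner_oscRot_swap lam Z X, inner_oscRot_swap lam Z Y, inner_oscRot_swap lam Y X] at h
  linear_combination h / 2

end Connection

/-- If `λ₁ = … = λ_k = λ > 0` and `λ_{k+1} = … = λₙ = −λ`, then every unit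
`V = Σᵢ (aᵢ eᵢ + a_{n+i} e_{n+i})` with
`Σ_{i≤k} (aᵢ² + a_{n+i}²) = Σ_{i>k} (aᵢ² + a_{n+i}²)` is a minimal unit vector field. -/
theorem minimal_mixed_lambdas (n : ℕ) (hn : 1 ≤ n) (k : ℕ) (hk1 : 1 ≤ k) (hkn : k < n)
    (lam : Fin n → ℝ) (lam0 : ℝ) (hlam0 : 0 < lam0)
    (hlam : ∀ i : Fin n, lam i = if i.1 < k then lam0 else -lam0)
    (br nab : Osc n →ₗ[ℝ] Osc n →ₗ[ℝ] Osc n)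
    (hbr : IsOscBracket n lam br) (hlc : IsLeviCivita n br nab)
    (a b : Fin n → ℝ) (V : Osc n)
    (hV : V = ∑ i, (a i • oe n i + b i • oE n i)) (hVunit : ‖V‖ = 1)
    (hbal : ∑ i ∈ Finset.univ.filter (fun i : Fin n => i.1 < k), ((a i)^2 + (b i)^2)
      = ∑ i ∈ Finset.univ.filter (fun i : Fin n => ¬ i.1 < k), ((a i)^2 + (b i)^2)) :
    IsMinimal br nab V := by
  classical
  set p := oscRot n 1 V with hp
  set q := oscRot n lam V with hq
  have hlamsq : ∀ i, lam i ^ 2 = lam0 ^ 2 := fun i => by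
    rw [hlam i]; split_ifs <;> ring
  have hJp : oscRot n 1 p = -V := by
    have := oscRot_oscRot_horizontal (1 : Fin n → ℝ) (κ := 1) (by simp) a b
    rwa [one_smul, ← hV] at this
  have hDq : oscRot n lam q = -(lam0 ^ 2 • V) := by
    have := oscRot_oscRot_horizontal lam hlamsq a b
    rwa [← hV] at this
  have hVV : ⟪V, V⟫ = (1 : ℝ) := by rw [real_inner_self_eq_norm_sq, hVunit]; norm_num
  have hpp : ⟪p, p⟫ = (1 : ℝ) := by
    rw [hp, inner_oscRot_swap, ← hp, hJp, inner_neg_left, hVV, neg_neg]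
  have hpq : ⟪p, q⟫ = (0 : ℝ) := by
    have h := inner_oscRot_one_oscRot_horizontal lam a b
    rw [← hV] at h
    rw [hp, hq, h, ← Finset.sum_filter_add_sum_filter_not univ (fun i : Fin n => i.1 < k)]
    have h1 : ∑ i ∈ univ.filter (fun i : Fin n => i.1 < k), lam i * (a i ^ 2 + b i ^ 2)
        = lam0 * ∑ i ∈ univ.filter (fun i : Fin n => i.1 < k), (a i ^ 2 + b i ^ 2) := by
      rw [Finset.mul_sum]
      refine Finset.sum_congr rfl fun i hi => ?_
      rw [hlam i, if_pos (Finset.mem_filter.mp hi).2]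
    have h2 : ∑ i ∈ univ.filter (fun i : Fin n => ¬ i.1 < k), lam i * (a i ^ 2 + b i ^ 2)
        = -lam0 * ∑ i ∈ univ.filter (fun i : Fin n => ¬ i.1 < k), (a i ^ 2 + b i ^ 2) := by
      rw [Finset.mul_sum]
      refine Finset.sum_congr rfl fun i hi => ?_
      rw [hlam i, if_neg (Finset.mem_filter.mp hi).2]
    rw [h1, h2, hbal]
    ring
  have hqp : ⟪q, p⟫ = (0 : ℝ) := by rw [real_inner_comm, hpq]
  have hqq : ⟪q, q⟫ = lam0 ^ 2 := by
    rw [hq, inner_oscRot_swap, ← hq, hDq, inner_neg_left, real_inner_smul_left, hVV]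
    ring
  have hpV : ⟪p, V⟫ = (0 : ℝ) := inner_oscRot_self _ _
  have hVp : ⟪V, p⟫ = (0 : ℝ) := by rw [real_inner_comm, hpV]
  have hpx : ⟪p, oXi n⟫ = (0 : ℝ) := inner_oscRot_oXi _ _
  have hpz : ⟪p, oZeta n⟫ = (0 : ℝ) := inner_oscRot_oZeta _ _
  have hqx : ⟪q, oXi n⟫ = (0 : ℝ) := inner_oscRot_oXi _ _
  have hqz : ⟪q, oZeta n⟫ = (0 : ℝ) := inner_oscRot_oZeta _ _
  have hxp : ⟪oXi n, p⟫ = (0 : ℝ) := by rw [real_inner_comm, hpx]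
  have hzp : ⟪oZeta n, p⟫ = (0 : ℝ) := by rw [real_inner_comm, hpz]
  have hxq : ⟪oXi n, q⟫ = (0 : ℝ) := by rw [real_inner_comm, hqx]
  have hVx : ⟪V, oXi n⟫ = (0 : ℝ) := by
    simp [hV, sum_inner, inner_add_left, real_inner_smul_left, inner_oe_oXi, inner_oE_oXi]
  have hVz : ⟪V, oZeta n⟫ = (0 : ℝ) := by
    simp [hV, sum_inner, inner_add_left, real_inner_smul_left, inner_oe_oZeta, inner_oE_oZeta]
  have hnab := hlc.apply hbr
  have hA : ∀ X, nomizu nab V X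
      = (1 / 2 * ⟪X, p⟫) • oXi n + (1 / 2 * ⟪X, oXi n⟫) • p - ⟪X, oZeta n⟫ • q := fun X => by
    rw [nomizu, hnab, inner_oscRot_swap, ← hp, ← hq, hVx, real_inner_comm]
    module
  have hAp : nomizu nab V p = (1 / 2 : ℝ) • oXi n := by
    rw [hA, hpp, hpx, hpz]; module
  have hAx : nomizu nab V (oXi n) = (1 / 2 : ℝ) • p := by
    rw [hA, hxp, inner_oXi_oXi, inner_oXi_oZeta]; module
  have hAz : nomizu nab V (oZeta n) = -q := by
    rw [hA, hzp, inner_oZeta_oXi, inner_oZeta_oZeta]; module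
  have hA0 : nomizu nab V 0 = 0 := by simp [nomizu]
  set T : Osc n → Osc n := fun u => covNomizu nab V u u +
    nomizu nab V (curvR br nab V (nomizu nab V u) u) with hT
  have hTp : T p = (1 / 4 : ℝ) • V := by
    have hR : curvR br nab V ((1 / 2 : ℝ) • oXi n) p = 0 := by
      simp [curvR, hbr.apply, hnab, ← hp, ← hq, hJp, oscRot_oXi, hpx, hVx, hVz, hpV, inner_oXi_oZeta,
        real_inner_smul_left, real_inner_smul_right, inner_zero_left]
    have hc : nab p p = 0 := by
      simp [hnab, hpx, hpz, inner_oscRot_self]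
    simp only [hT, covNomizu, hAp, hR, hA0, hc]
    simp only [hnab, hJp, real_inner_smul_left, real_inner_smul_right, inner_neg_left, hVx,
      hpx, hpz, inner_oXi_oXi]
    module
  have hTx : T (oXi n) = (1 / 4 : ℝ) • V := by
    have hR : curvR br nab V ((1 / 2 : ℝ) • p) (oXi n) = 0 := by
      simp [curvR, hbr.apply, hnab, ← hp, ← hq, hJp, oscRot_oXi, hpx, hpz, hVx, hVz, hpV, hVp,
        inner_oXi_oZeta, real_inner_smul_left, real_inner_smul_right]
    have hc : nab (oXi n) (oXi n) = 0 := by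
      simp [hnab, oscRot_oXi, inner_oXi_oZeta]
    simp only [hT, covNomizu, hAx, hR, hA0, hc]
    simp only [hnab, map_smul, hJp, oscRot_oXi, inner_zero_left, real_inner_smul_left,
      inner_oXi_oXi, inner_oXi_oZeta]
    module
  have hTz : T (oZeta n) = lam0 ^ 2 • V := by
    have hR : curvR br nab V (-q) (oZeta n) = 0 := by
      simp [curvR, hbr.apply, hnab, ← hp, ← hq, oscRot_oXi, oscRot_oZeta, hpz, hqz, hVz,
        inner_oscRot_oZeta, inner_oZeta_oXi, inner_oXi_oZeta]
    have hc : nab (oZeta n) (oZeta n) = 0 := by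
      simp [hnab, oscRot_oZeta, inner_oZeta_oXi]
    simp only [hT, covNomizu, hAz, hR, hA0, hc]
    simp only [hnab, map_neg, hDq, oscRot_oZeta, inner_zero_left, inner_oZeta_oXi,
      inner_oZeta_oZeta, inner_neg_left, hqx]
    module
  have hT0 : ∀ u, ⟪u, p⟫ = (0 : ℝ) → ⟪u, oXi n⟫ = (0 : ℝ) → ⟪u, oZeta n⟫ = (0 : ℝ) →
      nomizu nab V u = 0 ∧ T u = 0 := fun u h1 h2 h3 => by
    have hAu : nomizu nab V u = 0 := by rw [hA, h1, h2, h3]; module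
    have hc : nab u u = 0 := by simp [hnab, h2, h3, inner_oscRot_self]
    refine ⟨hAu, ?_⟩
    simp [hT, covNomizu, hAu, hc, hA0, curvR]
  let ip : Fin (2 * n + 2) := ⟨0, by omega⟩
  let ix : Fin (2 * n + 2) := ⟨2 * n, by omega⟩
  let iz : Fin (2 * n + 2) := ⟨2 * n + 1, by omega⟩
  have hxpi : ix ≠ ip := by simp only [ix, ip, ne_eq, Fin.mk.injEq]; omega
  have hzpi : iz ≠ ip := by simp [iz, ip]
  have hzxi : iz ≠ ix := by simp [iz, ix]
  let f : Fin (2 * n + 2) → Osc n := fun i =>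
    if i = ip then p else if i = ix then oXi n else oZeta n
  have hf : Orthonormal ℝ (({ip, ix, iz} : Set (Fin (2 * n + 2))).domRestrict f) := by
    rw [orthonormal_iff_ite]
    rintro ⟨i, hi⟩ ⟨j, hj⟩
    simp only [Set.mem_insert_iff, Set.mem_singleton_iff] at hi hj
    change ⟪f i, f j⟫ = _
    rcases hi with rfl | rfl | rfl <;> rcases hj with rfl | rfl | rfl <;>
      simp only [f, ↓reduceIte, Subtype.mk.injEq, hxpi, hzpi, hzxi, hxpi.symm, hzpi.symm, hzxi.symm, hpp, hpx, hpz, hxp, hzp,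
        inner_oXi_oXi, inner_oXi_oZeta, inner_oZeta_oXi, inner_oZeta_oZeta]
  obtain ⟨u, hu⟩ := hf.exists_orthonormalBasis_extension_of_card_eq (by simp)
  have hup : u ip = p := by rw [hu ip (by simp)]; simp [f]
  have hux : u ix = oXi n := by rw [hu ix (by simp)]; simp [f, hxpi]
  have huz : u iz = oZeta n := by rw [hu iz (by simp)]; simp [f, hzpi, hzxi]
  have hon := orthonormal_iff_ite.mp u.orthonormal
  have hrest : ∀ i, i ≠ ip → i ≠ ix → i ≠ iz → nomizu nab V (u i) = 0 ∧ T (u i) = 0 :=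
    fun i h1 h2 h3 => hT0 _ (by rw [← hup, hon, if_neg h1]) (by rw [← hux, hon, if_neg h2])
      (by rw [← huz, hon, if_neg h3])
  let σ : Fin (2 * n + 2) → ℝ := fun i =>
    if i = ip then 1 / 2 else if i = ix then 1 / 2 else if i = iz then lam0 else 0
  have hσp : σ ip = 1 / 2 := by simp [σ]
  have hσx : σ ix = 1 / 2 := by simp [σ]
  have hσz : σ iz = lam0 := by simp [σ, hzpi, hzxi]
  have hσ0 : ∀ i, i ≠ ip → i ≠ ix → i ≠ iz → σ i = 0 := fun i h1 h2 h3 => by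
    simp [σ, h1, h2, h3]
  refine ⟨u, σ, hon, fun i W => ?_, ?_⟩
  · by_cases h1 : i = ip
    · rw [h1, hup, hσp, hAp, hA W]
      simp only [inner_add_left, inner_sub_left, real_inner_smul_left, real_inner_smul_right,
        inner_oXi_oXi, hpx, hqx]
      ring
    by_cases h2 : i = ix
    · rw [h2, hux, hσx, hAx, hA W]
      simp only [inner_add_left, inner_sub_left, real_inner_smul_left, real_inner_smul_right,
        hxp, hpp, hqp]
      ring
    by_cases h3 : i = iz
    · rw [h3, huz, hσz, hAz, hA W]
      simp only [inner_add_left, inner_sub_left, real_inner_smul_left, inner_neg_right,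
        hxq, hpq, hqq]
      ring
    rw [(hrest i h1 h2 h3).1, hσ0 i h1 h2 h3, inner_zero_right]
    ring
  · rw [Finset.sum_smul]
    refine Finset.sum_congr rfl fun i _ => ?_
    change (1 + σ i ^ 2)⁻¹ • T (u i) = _
    by_cases h1 : i = ip
    · rw [h1, hup, hσp, hTp, smul_smul]
      norm_num
    by_cases h2 : i = ix
    · rw [h2, hux, hσx, hTx, smul_smul]
      norm_num
    by_cases h3 : i = iz
    · rw [h3, huz, hσz, hTz, smul_smul, div_eq_inv_mul]
    rw [(hrest i h1 h2 h3).2, hσ0 i h1 h2 h3]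
    simp
end
end

section
/- Suppose λ₁ = λ₂ = … = λₙ. Then every unit vector V of the oscillator algebra 𝔤ₙ(λ) that defines a harmonic map (i.e. Σᵢ (∇_{uᵢ} A_V)uᵢ = ‖A_V‖² V and Σᵢ R(V, A_V uᵢ)uᵢ = 0 for an orthonormal basis u₁, …, u_{2n+2} of 𝔤ₙ(λ), where ‖A_V‖² is the squared Frobenius norm of A_V) is a minimal unit vector field. -/
open scoped RealInnerProductSpace
open Finset

noncomputable section

section

variable {n : ℕ}

/-- A property closed under addition and scaling holds on `Osc n` if it holds on the basis. -/
theorem osc_induction {p : Osc n → Prop} (hadd : ∀ X Y, p X → p Y → p (X + Y))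
    (hsmul : ∀ (c : ℝ) X, p X → p (c • X)) (he : ∀ i, p (oe n i)) (hE : ∀ i, p (oE n i))
    (hxi : p (oXi n)) (hzeta : p (oZeta n)) (X : Osc n) : p X := by
  have hs : ∀ k : Fin (2*n+2), p (EuclideanSpace.single k 1) := by
    intro k
    obtain ⟨k, hk⟩ := k
    by_cases h1 : k < n
    · exact he ⟨k, h1⟩
    by_cases h2 : k < 2 * n
    · have h := hE ⟨k - n, by omega⟩
      have hnk : n + (k - n) = k := by omega
      simpa [oE, hnk] using h
    by_cases h3 : k = 2 * n
    · subst h3; exact hxi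
    · obtain rfl : k = 2 * n + 1 := by omega
      exact hzeta
  rw [← (EuclideanSpace.basisFun (Fin (2*n+2)) ℝ).sum_repr X]
  refine Finset.sum_induction _ p hadd ?_ fun k _ => hsmul _ _ ?_
  · simpa using hsmul 0 _ hxi
  · simpa using hs k

theorem inner_oXi_oe (i : Fin n) : ⟪oXi n, oe n i⟫ = (0 : ℝ) := by
  rw [real_inner_comm, inner_oe_oXi]

theorem inner_oZeta_oe (i : Fin n) : ⟪oZeta n, oe n i⟫ = (0 : ℝ) := by
  rw [real_inner_comm, inner_oe_oZeta]

theorem inner_oXi_oE (i : Fin n) : ⟪oXi n, oE n i⟫ = (0 : ℝ) := by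
  rw [real_inner_comm, inner_oE_oXi]

theorem inner_oZeta_oE (i : Fin n) : ⟪oZeta n, oE n i⟫ = (0 : ℝ) := by
  rw [real_inner_comm, inner_oE_oZeta]

theorem norm_oXi : ‖oXi n‖ = 1 := by
  simp [oXi]

theorem norm_oZeta : ‖oZeta n‖ = 1 := by
  simp [oZeta]

theorem exists_isPhi (n : ℕ) : ∃ J : Osc n →ₗ[ℝ] Osc n, IsPhi n J := by
  refine ⟨∑ i, ((innerₛₗ ℝ (oe n i)).smulRight (oE n i) -
    (innerₛₗ ℝ (oE n i)).smulRight (oe n i)), ?_, ?_, ?_, ?_⟩ <;>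
  simp [inner_oe_oe, inner_oE_oE, inner_oe_oE, inner_oE_oe, inner_oe_oXi, inner_oE_oXi,
    inner_oe_oZeta, inner_oE_oZeta, ite_smul]

namespace IsPhi

variable {J : Osc n →ₗ[ℝ] Osc n}

theorem inner_left (hJ : IsPhi n J) (X Y : Osc n) : ⟪J X, Y⟫ = -⟪X, J Y⟫ := by
  induction X using osc_induction with
  | hadd X₁ X₂ h₁ h₂ => simp only [map_add, inner_add_left, h₁, h₂]; ring
  | hsmul c X h => simp only [map_smul, real_inner_smul_left, h]; ring
  | _ =>
    induction Y using osc_induction with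
    | hadd X₁ X₂ h₁ h₂ => simp only [map_add, inner_add_right, h₁, h₂]; ring
    | hsmul c X h => simp only [map_smul, real_inner_smul_right, h]; ring
    | _ =>
      simp [hJ.he, hJ.hE, hJ.hxi, hJ.hzeta, inner_oe_oe, inner_oE_oE, inner_oe_oE, inner_oE_oe,
        inner_oe_oXi, inner_oE_oXi, inner_oe_oZeta, inner_oE_oZeta, inner_oXi_oe, inner_oXi_oE,
        inner_oZeta_oe, inner_oZeta_oE]

theorem sq_apply (hJ : IsPhi n J) (X : Osc n) :
    J (J X) = -X + ⟪X, oXi n⟫ • oXi n + ⟪X, oZeta n⟫ • oZeta n := by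
  induction X using osc_induction with
  | hadd X₁ X₂ h₁ h₂ => simp only [map_add, inner_add_left, h₁, h₂]; module
  | hsmul c X h => simp only [map_smul, real_inner_smul_left, h]; module
  | _ =>
    simp [hJ.he, hJ.hE, hJ.hxi, hJ.hzeta, inner_oe_oXi, inner_oE_oXi, inner_oe_oZeta,
      inner_oE_oZeta, norm_oXi, inner_oXi_oZeta, inner_oZeta_oXi, norm_oZeta]

theorem inner_apply_swap (hJ : IsPhi n J) (X Y : Osc n) : ⟪J X, Y⟫ = -⟪J Y, X⟫ := by
  rw [hJ.inner_left, real_inner_comm]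

theorem inner_apply_oXi (hJ : IsPhi n J) (X : Osc n) : ⟪J X, oXi n⟫ = (0 : ℝ) := by
  simp [hJ.inner_left, hJ.hxi]

theorem inner_apply_oZeta (hJ : IsPhi n J) (X : Osc n) : ⟪J X, oZeta n⟫ = (0 : ℝ) := by
  simp [hJ.inner_left, hJ.hzeta]

theorem inner_apply_self (hJ : IsPhi n J) (X : Osc n) : ⟪X, J X⟫ = (0 : ℝ) := by
  have h := hJ.inner_left X X
  rw [real_inner_comm] at h
  linarith

theorem inner_apply_apply (hJ : IsPhi n J) (X Y : Osc n) :
    ⟪J X, J Y⟫ = ⟪X, Y⟫ - ⟪X, oXi n⟫ * ⟪Y, oXi n⟫ - ⟪X, oZeta n⟫ * ⟪Y, oZeta n⟫ := by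
  rw [hJ.inner_left, hJ.sq_apply]
  simp only [inner_add_right, inner_neg_right, real_inner_smul_right]
  ring

end IsPhi

variable {l : ℝ} {J : Osc n →ₗ[ℝ] Osc n} {br nab : Osc n →ₗ[ℝ] Osc n →ₗ[ℝ] Osc n}

theorem IsOscBracket.apply_eq (hbr : IsOscBracket n (fun _ => l) br) (hJ : IsPhi n J)
    (X Y : Osc n) :
    br X Y = ⟪J X, Y⟫ • oXi n + (l * ⟪X, oZeta n⟫) • J Y - (l * ⟪Y, oZeta n⟫) • J X := by
  have hself : ∀ X, br X X = 0 := fun X => by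
    linear_combination (norm := module) (1 / 2 : ℝ) • hbr.anti X X
  induction X using osc_induction with
  | hadd X₁ X₂ h₁ h₂ =>
    simp only [map_add, LinearMap.add_apply, inner_add_left, h₁, h₂]; module
  | hsmul c X h =>
    simp only [map_smul, LinearMap.smul_apply, real_inner_smul_left, h]; module
  | _ =>
    induction Y using osc_induction with
    | hadd X₁ X₂ h₁ h₂ => simp only [map_add, inner_add_right, inner_add_left, h₁, h₂]; module
    | hsmul c X h =>
      simp only [map_smul, real_inner_smul_right, real_inner_smul_left, h]; module
    | _ =>
      simp [hJ.he, hJ.hE, hJ.hxi, hJ.hzeta, inner_oe_oe, inner_oE_oE, inner_oe_oE, inner_oE_oe,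
        inner_oe_oXi, inner_oE_oXi, inner_oe_oZeta, inner_oE_oZeta, inner_oXi_oZeta,
        norm_oZeta, hself, hbr.ee, hbr.eE, hbr.EE, hbr.exi, hbr.Exi, hbr.zee, hbr.zeE,
        hbr.xize, hbr.anti (oE n _) (oe n _), hbr.anti (oXi n) (oe n _),
        hbr.anti (oXi n) (oE n _), hbr.anti (oe n _) (oZeta n), hbr.anti (oE n _) (oZeta n),
        hbr.anti (oZeta n) (oXi n), eq_comm]

theorem IsLeviCivita.apply_eq (hlc : IsLeviCivita n br nab)
    (hbr : IsOscBracket n (fun _ => l) br) (hJ : IsPhi n J) (X Y : Osc n) :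
    nab X Y = (⟪J X, Y⟫ / 2) • oXi n - (⟪Y, oXi n⟫ / 2) • J X +
      (l * ⟪X, oZeta n⟫ - ⟪X, oXi n⟫ / 2) • J Y := by
  refine ext_inner_right ℝ fun Z => ?_
  have h := hlc X Y Z
  simp only [hbr.apply_eq hJ, inner_add_left, inner_sub_left, real_inner_smul_left] at h ⊢
  rw [hJ.inner_apply_swap Z X, hJ.inner_apply_swap Y X, hJ.inner_apply_swap Z Y] at h
  simp only [real_inner_comm _ (oXi n)] at h ⊢
  linarith

theorem curvR_eq (hlc : IsLeviCivita n br nab) (hbr : IsOscBracket n (fun _ => l) br)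
    (hJ : IsPhi n J) (X Y Z : Osc n) :
    curvR br nab X Y Z = (-⟪J Y, Z⟫ / 4) • J X + (⟪J X, Z⟫ / 4) • J Y + (⟪J X, Y⟫ / 2) • J Z
      + (⟪X, oXi n⟫ * ⟪J Y, J Z⟫ / 4 - ⟪Y, oXi n⟫ * ⟪J X, J Z⟫ / 4) • oXi n
      - (⟪Y, oXi n⟫ * ⟪Z, oXi n⟫ / 4) • J (J X) + (⟪X, oXi n⟫ * ⟪Z, oXi n⟫ / 4) • J (J Y) := by
  have hsq : ∀ X Y, ⟪J (J X), Y⟫ = -⟪J X, J Y⟫ := fun X Y => hJ.inner_left _ _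
  simp only [curvR, hlc.apply_eq hbr hJ, hbr.apply_eq hJ, map_add, map_sub, map_smul,
    LinearMap.add_apply, LinearMap.sub_apply, LinearMap.smul_apply, hJ.hxi,
    inner_add_left, inner_add_right, inner_sub_left, inner_sub_right, real_inner_smul_left,
    real_inner_smul_right, hJ.inner_apply_oXi, hJ.inner_apply_oZeta, inner_oXi_oXi,
    inner_oXi_oZeta, inner_zero_left, hsq]
  rw [real_inner_comm (J X) (J Y)]
  module

theorem nomizu_eq (hlc : IsLeviCivita n br nab) (hbr : IsOscBracket n (fun _ => l) br)
    (hJ : IsPhi n J) (V X : Osc n) :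
    nomizu nab V X = (⟪X, J V⟫ / 2) • oXi n + (⟪V, oXi n⟫ / 2) • J X +
      (⟪X, oXi n⟫ / 2 - l * ⟪X, oZeta n⟫) • J V := by
  rw [nomizu, hlc.apply_eq hbr hJ, hJ.inner_left]
  module

/-- An orthonormal family indexed by the coordinates of `Osc n` is an orthonormal basis. -/
theorem exists_orthonormalBasis_eq {u : Fin (2*n+2) → Osc n}
    (hu : ∀ i j, ⟪u i, u j⟫ = if i = j then (1 : ℝ) else 0) :
    ∃ b : OrthonormalBasis (Fin (2*n+2)) ℝ (Osc n), ⇑b = u := by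
  have ho : Orthonormal ℝ u := orthonormal_iff_ite.2 hu
  refine ⟨(basisOfOrthonormalOfCardEqFinrank ho (by simp)).toOrthonormalBasis
    (by simpa using ho), by simp⟩

/-- Minimality follows once every unit vector of an orthonormal family `v`, and every unit vector
orthogonal to `v`, is an eigenvector of `A_Vᵀ A_V` whose own contribution is a multiple of `V`. -/
theorem isMinimal_of_orthonormal {ι : Type*} {v : ι → Osc n} (hv : Orthonormal ℝ v) {V : Osc n}
    (h : ∀ u, ‖u‖ = 1 → ((∃ k, v k = u) ∨ ∀ k, ⟪u, v k⟫ = (0 : ℝ)) → ∃ σ : ℝ,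
      (∀ W, ⟪nomizu nab V W, nomizu nab V u⟫ = σ ^ 2 * ⟪W, u⟫) ∧
      covNomizu nab V u u + nomizu nab V (curvR br nab V (nomizu nab V u) u) = σ ^ 2 • V) :
    IsMinimal br nab V := by
  obtain ⟨s, b, hs, hb⟩ := hv.toSubtypeRange.exists_orthonormalBasis_extension
  have hcard : Fintype.card s = Fintype.card (Fin (2*n+2)) := by
    rw [← Module.finrank_eq_card_basis b.toBasis]; simp
  let c := b.reindex (Fintype.equivOfCardEq hcard)
  have hc : ∀ i, (∃ k, v k = c i) ∨ ∀ k, ⟪c i, v k⟫ = (0 : ℝ) := by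
    intro i
    by_cases hi : ∃ k, v k = c i
    · exact Or.inl hi
    · refine Or.inr fun k => ?_
      have hk : c (Fintype.equivOfCardEq hcard ⟨v k, hs ⟨k, rfl⟩⟩) = v k := by simp [c, hb]
      rw [← hk]
      refine c.orthonormal.2 ?_
      rintro rfl
      exact hi ⟨k, hk.symm⟩
  choose σ h1 h2 using fun i => h (c i) (c.orthonormal.1 i) (hc i)
  refine ⟨c, σ, orthonormal_iff_ite.1 c.orthonormal, h1, ?_⟩
  rw [Finset.sum_smul]
  refine Finset.sum_congr rfl fun i _ => ?_
  rw [h2, smul_smul]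
  congr 1
  ring

theorem isMinimal_of_nomizu_eq_zero {V : Osc n} (h : ∀ X, nomizu nab V X = 0) :
    IsMinimal br nab V := by
  have h0 : Orthonormal ℝ (Empty.elim : Empty → Osc n) := ⟨fun i => i.elim, fun i => i.elim⟩
  exact isMinimal_of_orthonormal h0 fun u _ _ => ⟨0, by simp [h, covNomizu]⟩

theorem isMinimal_of_eq_smul_oXi (hlc : IsLeviCivita n br nab)
    (hbr : IsOscBracket n (fun _ => l) br) (hJ : IsPhi n J) {a : ℝ} (ha : a ^ 2 = 1) :
    IsMinimal br nab (a • oXi n) := by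
  have hv : Orthonormal ℝ ![oXi n, oZeta n] := by
    simp [orthonormal_vecCons_iff, norm_oXi, norm_oZeta, inner_oXi_oZeta]
  have hA : ∀ X, nomizu nab (a • oXi n) X = (a / 2) • J X := by
    intro X
    simp [nomizu_eq hlc hbr hJ, hJ.hxi, real_inner_smul_left, norm_oXi]
  refine isMinimal_of_orthonormal hv fun u hu h => ?_
  rcases h with ⟨k, rfl⟩ | h
  · refine ⟨0, ?_⟩
    fin_cases k <;>
    simp [hA, covNomizu, hlc.apply_eq hbr hJ, curvR_eq hlc hbr hJ, hJ.hxi, hJ.hzeta]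
  · have hx : ⟪u, oXi n⟫ = (0 : ℝ) := h 0
    have hz : ⟪u, oZeta n⟫ = (0 : ℝ) := h 1
    have huu : ⟪J u, J u⟫ = (1 : ℝ) := by
      rw [hJ.inner_apply_apply, hx, hz, real_inner_self_eq_norm_sq, hu]; norm_num
    refine ⟨1 / 2, fun W => ?_, ?_⟩
    · rw [hA, hA, real_inner_smul_left, real_inner_smul_right, hJ.inner_apply_apply, hx, hz]
      linear_combination ⟪W, u⟫ / 4 * ha
    · have hJu : ⟪J u, u⟫ = (0 : ℝ) := by rw [real_inner_comm, hJ.inner_apply_self]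
      have hR : nomizu nab (a • oXi n)
          (curvR br nab (a • oXi n) (nomizu nab (a • oXi n) u) u) = 0 := by
        simp [hA, curvR_eq hlc hbr hJ, hJ.hxi, hx]
      rw [hR, covNomizu]
      simp only [hA, hlc.apply_eq hbr hJ, hJu, hx, hz, map_add, map_sub, map_smul,
        real_inner_smul_right, real_inner_smul_left, huu, hJ.inner_apply_oXi, hJ.hxi]
      module

theorem isMinimal_of_inner_eq_zero (hlc : IsLeviCivita n br nab)
    (hbr : IsOscBracket n (fun _ => l) br) (hJ : IsPhi n J) {V : Osc n} (hV : ‖V‖ = 1)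
    (hx : ⟪V, oXi n⟫ = (0 : ℝ)) (hz : ⟪V, oZeta n⟫ = (0 : ℝ)) : IsMinimal br nab V := by
  set P := J V with hP
  set r : ℝ := √(1 / 4 + l ^ 2)
  have hr2 : r ^ 2 = 1 / 4 + l ^ 2 := Real.sq_sqrt (by positivity)
  have hr0 : r ≠ 0 := by positivity
  set v : Osc n := r⁻¹ • ((1 / 2 : ℝ) • oXi n - l • oZeta n) with hvdef
  have hJv : J v = 0 := by simp [hvdef, hJ.hxi, hJ.hzeta]
  have hJP : J P = -V := by simp [hP, hJ.sq_apply, hx, hz]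
  have hPx : ⟪P, oXi n⟫ = (0 : ℝ) := hJ.inner_apply_oXi V
  have hPz : ⟪P, oZeta n⟫ = (0 : ℝ) := hJ.inner_apply_oZeta V
  have hPP : ⟪P, P⟫ = (1 : ℝ) := by
    rw [hJ.inner_apply_apply, hx, hz, real_inner_self_eq_norm_sq, hV]; norm_num
  have hVP : ⟪V, P⟫ = (0 : ℝ) := hJ.inner_apply_self V
  have hVv : ⟪V, v⟫ = (0 : ℝ) := by
    simp [hvdef, inner_sub_right, real_inner_smul_right, hx, hz]
  have hPv : ⟪P, v⟫ = (0 : ℝ) := by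
    simp [hvdef, inner_sub_right, real_inner_smul_right, hPx, hPz]
  have hvv : ⟪v, v⟫ = (1 : ℝ) := by
    simp only [hvdef, inner_sub_right, inner_sub_left, real_inner_smul_right,
      real_inner_smul_left, inner_oXi_oXi, inner_oXi_oZeta, inner_oZeta_oXi, inner_oZeta_oZeta]
    field_simp
    linarith
  have hPV : ⟪P, V⟫ = (0 : ℝ) := by rw [real_inner_comm, hVP]
  have hvP : ⟪v, P⟫ = (0 : ℝ) := by rw [real_inner_comm, hPv]
  have hPn : ‖P‖ = 1 := by rw [norm_eq_sqrt_real_inner, hPP, Real.sqrt_one]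
  have hvn : ‖v‖ = 1 := by rw [norm_eq_sqrt_real_inner, hvv, Real.sqrt_one]
  have hrv : ∀ X, r * ⟪X, v⟫ = ⟪X, oXi n⟫ / 2 - l * ⟪X, oZeta n⟫ := by
    intro X
    simp only [hvdef, inner_sub_right, real_inner_smul_right]
    field_simp
  have hA : ∀ X, nomizu nab V X = (⟪X, P⟫ / 2) • oXi n + (r * ⟪X, v⟫) • P := by
    intro X
    rw [hrv, nomizu_eq hlc hbr hJ, hx]
    simp [hP]
  have hvo : Orthonormal ℝ ![P, V, v] := by
    simp [orthonormal_vecCons_iff, hPn, hvn, hPV, hV, hVv, hPv]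
  refine isMinimal_of_orthonormal hvo fun u hu h => ?_
  rcases h with ⟨k, rfl⟩ | h
  · fin_cases k
    · refine ⟨1 / 2, fun W => ?_, ?_⟩
      · simp [hA, inner_add_left, real_inner_smul_left, real_inner_smul_right, hPn, hPv, hPx,
          norm_oXi]
        ring
      · have hAP : nomizu nab V P = (1 / 2 : ℝ) • oXi n := by simp [hA, hPn, hPv]
        have hPPn : nab P P = 0 := by simp [hlc.apply_eq hbr hJ, hJP, hVP, hPx, hPz]
        have hR : curvR br nab V ((1 / 2 : ℝ) • oXi n) P = 0 := by
          simp [curvR_eq hlc hbr hJ, hJ.hxi, ← hP, hJP, hPx, hPV, hx, real_inner_smul_right]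
        change covNomizu nab V P P + nomizu nab V (curvR br nab V (nomizu nab V P) P) = _
        rw [hAP, hR, covNomizu, hAP, hPPn]
        simp only [hlc.apply_eq hbr hJ, hA, map_smul, hJ.hxi, hJP, real_inner_smul_left,
          real_inner_smul_right, inner_oXi_oXi, inner_zero_left, inner_neg_left, hx]
        module
    · have hAV : nomizu nab V V = 0 := by simp [hA, hVP, hVv]
      have hVVn : nab V V = 0 := by simpa [nomizu] using hAV
      refine ⟨0, fun W => ?_, ?_⟩
      · change ⟪nomizu nab V W, nomizu nab V V⟫ = _
        simp [hAV]
      · change covNomizu nab V V V + nomizu nab V (curvR br nab V (nomizu nab V V) V) = _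
        simp [covNomizu, hVVn, curvR, nomizu]
    · have hAv : nomizu nab V v = r • P := by simp [hA, hvn, hvP]
      refine ⟨r, fun W => ?_, ?_⟩
      · change ⟪nomizu nab V W, nomizu nab V v⟫ = r ^ 2 * ⟪W, v⟫
        rw [hAv, hA]
        simp only [inner_add_left, real_inner_smul_left, real_inner_smul_right, hPP,
          real_inner_comm _ (oXi n), hPx]
        ring
      · have hvvn : nab v v = 0 := by simp [hlc.apply_eq hbr hJ, hJv]
        have hR : curvR br nab V (r • P) v = 0 := by
          simp [curvR_eq hlc hbr hJ, hJv, ← hP, hJP, hPx, hPv, hVv, hx, real_inner_smul_left]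
        have hnvP : nab v P = r • V := by
          have hrz : l * ⟪v, oZeta n⟫ - ⟪v, oXi n⟫ / 2 = -r := by
            have := hrv v
            rw [hvv] at this
            linarith
          simp [hlc.apply_eq hbr hJ, hJv, hJP, hPx, hrz]
        change covNomizu nab V v v + nomizu nab V (curvR br nab V (nomizu nab V v) v) = _
        rw [hAv, hR, covNomizu, hAv, hvvn, map_smul, hnvP]
        simp [nomizu, smul_smul, sq]
  · have huP : ⟪u, P⟫ = (0 : ℝ) := h 0
    have huV : ⟪u, V⟫ = (0 : ℝ) := h 1
    have huv : ⟪u, v⟫ = (0 : ℝ) := h 2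
    have hAu : nomizu nab V u = 0 := by simp [hA, huP, huv]
    refine ⟨0, fun W => by simp [hAu], ?_⟩
    have hJu : nomizu nab V (J u) = 0 := by
      have h1 : ⟪J u, v⟫ = (0 : ℝ) := by simp [hJ.inner_left, hJv]
      have h2 : ⟪J u, P⟫ = (0 : ℝ) := by simp [hJ.inner_left, hJP, huV]
      simp [hA, h1, h2]
    have hnJu : nab (J u) V = 0 := by simpa [nomizu] using hJu
    have hself : ⟪J u, u⟫ = (0 : ℝ) := by rw [real_inner_comm, hJ.inner_apply_self]
    have hR : curvR br nab V 0 u = 0 := by simp [curvR]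
    rw [covNomizu, hAu, hR]
    simp [nomizu, hlc.apply_eq hbr hJ u u, hself, hnJu]

/-- The component along `J V` of the second harmonicity condition. -/
theorem sum_inner_curvR (hlc : IsLeviCivita n br nab) (hbr : IsOscBracket n (fun _ => l) br)
    (hJ : IsPhi n J) (V : Osc n) (b : OrthonormalBasis (Fin (2*n+2)) ℝ (Osc n)) :
    ⟪∑ i, curvR br nab V (nomizu nab V (b i)) (b i), J V⟫ =
      n / 4 * ⟪V, oXi n⟫ * ⟪J V, J V⟫ := by
  have hsum : ∀ X Y, ∑ i, ⟪b i, X⟫ * ⟪b i, Y⟫ = ⟪X, Y⟫ := fun X Y => by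
    simpa only [real_inner_comm X] using b.sum_inner_mul_inner X Y
  set a := ⟪V, oXi n⟫ with ha
  set w := ⟪J V, J V⟫ with hw
  have hJJ : ∀ X, J (J (J X)) = -J X := fun X => by
    simp [hJ.sq_apply (J X), hJ.inner_apply_oXi, hJ.inner_apply_oZeta]
  have hterm : ∀ u : Osc n, ⟪u, u⟫ = (1 : ℝ) → ⟪curvR br nab V (nomizu nab V u) u, J V⟫ =
      a * w / 8 - a * w / 4 * (⟪u, oXi n⟫ * ⟪u, oXi n⟫) - a * w / 8 * (⟪u, oZeta n⟫ * ⟪u, oZeta n⟫)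
      - a / 8 * (⟪u, J V⟫ * ⟪u, J V⟫) + a / 4 * (⟪u, J (J V)⟫ * ⟪u, J (J V)⟫)
      + a * w / 4 * l * (⟪u, oXi n⟫ * ⟪u, oZeta n⟫)
      + (a ^ 2 / 8 - 3 * w / 8) * (⟪u, oXi n⟫ * ⟪u, J (J V)⟫)
      + 3 * w * l / 4 * (⟪u, oZeta n⟫ * ⟪u, J (J V)⟫) := by
    intro u hu
    have h1 : ⟪J u, J u⟫ = 1 - ⟪u, oXi n⟫ * ⟪u, oXi n⟫ - ⟪u, oZeta n⟫ * ⟪u, oZeta n⟫ := by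
      rw [hJ.inner_apply_apply, hu]
    have h2 : ⟪J u, J V⟫ = -⟪u, J (J V)⟫ := hJ.inner_left _ _
    have h3 : ⟪J V, u⟫ = ⟪u, J V⟫ := real_inner_comm _ _
    have h4 : ⟪J (J V), u⟫ = ⟪u, J (J V)⟫ := real_inner_comm _ _
    have h5 : ⟪J (J u), u⟫ = -⟪J u, J u⟫ := hJ.inner_left _ _
    have h6 : ⟪J (J u), J V⟫ = -⟪u, J V⟫ := by
      rw [hJ.inner_left, hJ.inner_left, hJJ, inner_neg_right, neg_neg]
    have h7 : ⟪J V, J u⟫ = -⟪u, J (J V)⟫ := by rw [real_inner_comm, h2]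
    have h8 : ⟪J (J V), J V⟫ = (0 : ℝ) := by rw [real_inner_comm, hJ.inner_apply_self]
    simp only [curvR_eq hlc hbr hJ, nomizu_eq hlc hbr hJ, map_add, map_smul, hJ.hxi,
      inner_add_left, inner_sub_left, inner_add_right, real_inner_smul_left,
      real_inner_smul_right, hJJ, inner_neg_left, hJ.inner_apply_oXi, real_inner_comm _ (oXi n),
      smul_zero, map_zero, inner_zero_left, h1, h2, h3, h4, h5, h6, h7, h8, ← ha, ← hw]
    ring
  have hxJ : ⟪oXi n, J (J V)⟫ = (0 : ℝ) := by rw [real_inner_comm, hJ.inner_apply_oXi]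
  have hzJ : ⟪oZeta n, J (J V)⟫ = (0 : ℝ) := by rw [real_inner_comm, hJ.inner_apply_oZeta]
  have hJJw : ⟪J (J V), J (J V)⟫ = w := by
    rw [hJ.inner_apply_apply, hJ.inner_apply_oXi, hJ.inner_apply_oZeta]
    ring
  rw [sum_inner, Finset.sum_congr rfl fun i _ => hterm (b i) (by simp)]
  simp only [Finset.sum_add_distrib, Finset.sum_sub_distrib, ← Finset.mul_sum, hsum,
    inner_oXi_oXi, inner_oZeta_oZeta, inner_oXi_oZeta, hxJ, hzJ, hJJw, ← hw,
    Finset.sum_const, Finset.card_univ, Fintype.card_fin, nsmul_eq_mul]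
  push_cast
  ring

theorem inner_nab_oZeta (hlc : IsLeviCivita n br nab) (hbr : IsOscBracket n (fun _ => l) br)
    (hJ : IsPhi n J) (X Y : Osc n) : ⟪nab X Y, oZeta n⟫ = (0 : ℝ) := by
  simp [hlc.apply_eq hbr hJ, inner_add_left, inner_sub_left, real_inner_smul_left,
    hJ.inner_apply_oZeta, inner_oXi_oZeta]

end

/-- If `λ₁ = … = λₙ`, then every unit vector `V` of the oscillator algebra defining a
harmonic map (i.e. `Σᵢ (∇_{uᵢ} A_V)uᵢ = ‖A_V‖² V` and `Σᵢ R(V, A_V uᵢ)uᵢ = 0` for an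
orthonormal basis `u₁, …, u_{2n+2}`, where `‖A_V‖²` is the squared Frobenius norm of
`A_V`) is a minimal unit vector field. -/
theorem harmonic_map_implies_minimal (n : ℕ) (hn : 1 ≤ n) (lam : Fin n → ℝ)
    (hlam : ∀ i j : Fin n, lam i = lam j)
    (br nab : Osc n →ₗ[ℝ] Osc n →ₗ[ℝ] Osc n)
    (hbr : IsOscBracket n lam br) (hlc : IsLeviCivita n br nab)
    (V : Osc n) (hVunit : ‖V‖ = 1)
    (hharm : ∃ u : Fin (2*n+2) → Osc n,
      (∀ i j, ⟪u i, u j⟫ = if i = j then 1 else 0) ∧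
      (∑ i, covNomizu nab V (u i) (u i))
        = (∑ i, ⟪nomizu nab V (u i), nomizu nab V (u i)⟫) • V ∧
      (∑ i, curvR br nab V (nomizu nab V (u i)) (u i)) = 0) :
    IsMinimal br nab V := by
  obtain ⟨u, hu, h1, h2⟩ := hharm
  obtain ⟨b, rfl⟩ := exists_orthonormalBasis_eq hu
  obtain ⟨J, hJ⟩ := exists_isPhi n
  obtain ⟨l, rfl⟩ : ∃ l : ℝ, lam = fun _ => l := ⟨lam ⟨0, hn⟩, funext fun i => hlam i _⟩
  have hcov : ⟪∑ i, covNomizu nab V (b i) (b i), oZeta n⟫ = (0 : ℝ) := by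
    simp [sum_inner, covNomizu, nomizu, inner_add_left, inner_nab_oZeta hlc hbr hJ]
  rw [h1, real_inner_smul_left, mul_eq_zero] at hcov
  rcases hcov with hc | hz
  · refine isMinimal_of_nomizu_eq_zero fun X => ?_
    rw [Finset.sum_eq_zero_iff_of_nonneg fun i _ => real_inner_self_nonneg] at hc
    have hb : ∀ i, nab (b i) V = 0 := fun i => by
      simpa [nomizu] using hc i (Finset.mem_univ i)
    rw [nomizu, ← b.sum_repr X]
    simp [hb]
  · have hcurv := sum_inner_curvR hlc hbr hJ V b
    rw [h2, inner_zero_left, eq_comm, mul_eq_zero, mul_eq_zero] at hcurv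
    have hn0 : (n : ℝ) / 4 ≠ 0 := by positivity
    rcases hcurv with (h | hx) | hJV
    · exact absurd h hn0
    · exact isMinimal_of_inner_eq_zero hlc hbr hJ hVunit hx hz
    · have hV := hJ.sq_apply V
      rw [inner_self_eq_zero.1 hJV, map_zero, hz, zero_smul, add_zero, eq_comm,
        neg_add_eq_zero] at hV
      have ha : ⟪V, oXi n⟫ ^ 2 = (1 : ℝ) := by
        rw [hV, norm_smul, norm_oXi, mul_one, Real.norm_eq_abs] at hVunit
        rw [← sq_abs, hVunit, one_pow]
      rw [hV]
      exact isMinimal_of_eq_smul_oXi hlc hbr hJ ha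
end
end
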